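/- (Corollary 1: standard self-testing of the GHZ state from the Svetlichny inequality, state part) Let N ≥ 2, let A_0^{(i)}, A_1^{(i)} be binary observables on ℂ^{d_i} for i = 1,…,N, and let ψ be a unit vector in ℂ^{d_1}⊗…⊗ℂ^{d_N} such that ⟨ψ, Ŝ_N^+ ψ⟩ = 2^{N−1}√2, where Ŝ_N^+ = Σ_{x ∈ {0,1}^N} (−1)^{w(x)(w(x)+1)/2} A_{x_1}^{(1)}⊗…⊗A_{x_N}^{(N)}. Then there exist natural numbers m_1,…,m_N, linear isometries V_i : ℂ^{d_i} → ℂ² ⊗ ℂ^{m_i}, and a unit vector ζ ∈ ℂ^{m_1}⊗…⊗ℂ^{m_N} such that, under the canonical isomorphism reordering the tensor factors, (V_1 ⊗ … ⊗ V_N) ψ = Φ^N ⊗ ζ, where Φ^N = (|0⟩^{⊗N} + |1⟩^{⊗N})/√2 is the N-partite GHZ state. -/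

import Mathlib

open Matrix

noncomputable section

/-- Hamming weight of a bit string. -/
def wt {n : ℕ} (x : Fin n → Fin 2) : ℕ := ∑ i, (x i : ℕ)

/-- The Svetlichny sign `(-1)^{w(x)(w(x)+1)/2}`. -/
def sgn {n : ℕ} (x : Fin n → Fin 2) : ℂ := (-1) ^ (wt x * (wt x + 1) / 2)

/-- The Svetlichny–Bell operator
`Ŝ_N^+ = Σ_x (-1)^{w(x)(w(x)+1)/2} A^{(1)}_{x_1} ⊗ ⋯ ⊗ A^{(N)}_{x_N}`, written entrywise. -/
def svetOp {N : ℕ} {d : Fin N → ℕ}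
    (A : (i : Fin N) → Fin 2 → Matrix (Fin (d i)) (Fin (d i)) ℂ) :
    Matrix ((i : Fin N) → Fin (d i)) ((i : Fin N) → Fin (d i)) ℂ :=
  ∑ x : Fin N → Fin 2,
    sgn x • (Matrix.of fun p q => ∏ i, A i (x i) (p i) (q i))

/-- The GHZ state `(|0…0⟩ + |1…1⟩)/√2` on the qubits indexed by `α`. -/
def ghzVec {α : Type*} [Fintype α] [DecidableEq α] : (α → Fin 2) → ℂ :=
  fun b => ((if b = fun _ => 0 then 1 else 0) + (if b = fun _ => 1 then 1 else 0)) /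
    (Real.sqrt 2 : ℂ)

/-- The action of the tensor product `V_1 ⊗ ⋯ ⊗ V_N` of the local isometries
`V_i : ℂ^{d i} → ℂ² ⊗ ℂ^{m i}` on a state `ψ`, written in components. -/
def tensorIsoAct {N : ℕ} {d m : Fin N → ℕ}
    (V : (i : Fin N) → Matrix (Fin 2 × Fin (m i)) (Fin (d i)) ℂ)
    (ψ : ((i : Fin N) → Fin (d i)) → ℂ) :
    ((i : Fin N) → Fin 2 × Fin (m i)) → ℂ :=
  fun f => ∑ x : (i : Fin N) → Fin (d i), (∏ i, V i (f i) (x i)) * ψ x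

/-- The tensor product of a family of square matrices, written entrywise. -/
def piKron {ι : Type*} [Fintype ι] {n : ι → Type*} (B : ∀ i, Matrix (n i) (n i) ℂ) :
    Matrix (∀ i, n i) (∀ i, n i) ℂ :=
  Matrix.of fun p q => ∏ i, B i (p i) (q i)

section PiKron

variable {ι : Type*} [Fintype ι] {n : ι → Type*}

lemma piKron_one [∀ i, DecidableEq (n i)] :
    piKron (fun i => (1 : Matrix (n i) (n i) ℂ)) = 1 := by
  ext p q
  simp only [piKron, Matrix.of_apply, Matrix.one_apply]
  rw [Fintype.prod_ite_zero]
  simp [funext_iff]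

lemma piKron_conjTranspose (B : ∀ i, Matrix (n i) (n i) ℂ) :
    (piKron B)ᴴ = piKron fun i => (B i)ᴴ := by
  ext p q
  simp [piKron, Matrix.conjTranspose_apply]

lemma piKron_smul (c : ι → ℂ) (B : ∀ i, Matrix (n i) (n i) ℂ) :
    piKron (fun i => c i • B i) = (∏ i, c i) • piKron B := by
  ext p q
  simp [piKron, Finset.prod_mul_distrib]

variable [DecidableEq ι]

lemma piKron_mul [∀ i, Fintype (n i)] (B C : ∀ i, Matrix (n i) (n i) ℂ) :
    piKron B * piKron C = piKron fun i => B i * C i := by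
  ext p q
  simp only [piKron, Matrix.mul_apply, Matrix.of_apply, ← Finset.prod_mul_distrib]
  rw [Finset.prod_univ_sum, Fintype.piFinset_univ]

lemma piKron_sum {κ : Type*} [Fintype κ] (E : ∀ i, κ → Matrix (n i) (n i) ℂ) :
    piKron (fun i => ∑ b, E i b) = ∑ b : ι → κ, piKron fun i => E i (b i) := by
  ext p q
  simp only [piKron, Matrix.of_apply, Matrix.sum_apply]
  rw [Finset.prod_univ_sum, Fintype.piFinset_univ]

/-- The matrix acting as `X` on the tensor factor `i` and trivially on the others. -/
def atSite [∀ i, DecidableEq (n i)] (i : ι) (X : Matrix (n i) (n i) ℂ) :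
    Matrix (∀ i, n i) (∀ i, n i) ℂ :=
  piKron (Function.update (fun _ => 1) i X)

variable [∀ i, DecidableEq (n i)]

lemma atSite_one (i : ι) : atSite i (1 : Matrix (n i) (n i) ℂ) = 1 := by
  rw [atSite, ← piKron_one (n := n)]
  congr 1
  exact Function.update_eq_self i _

lemma atSite_conjTranspose (i : ι) (X : Matrix (n i) (n i) ℂ) :
    (atSite i X)ᴴ = atSite i Xᴴ := by
  rw [atSite, piKron_conjTranspose, atSite]
  congr 1
  ext1 j
  rcases eq_or_ne j i with rfl | h <;> simp [*]

lemma atSite_add (i : ι) (X Y : Matrix (n i) (n i) ℂ) :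
    atSite i (X + Y) = atSite i X + atSite i Y := by
  ext p q
  simp only [atSite, piKron, Matrix.of_apply, Matrix.add_apply,
    Fintype.prod_eq_mul_prod_compl i, Function.update_self, add_mul]
  congr 2 <;>
  · refine Finset.prod_congr rfl fun j hj => ?_
    have : j ≠ i := by simpa using hj
    simp [this]

lemma atSite_neg (i : ι) (X : Matrix (n i) (n i) ℂ) : atSite i (-X) = -atSite i X := by
  have h0 : atSite i (0 : Matrix (n i) (n i) ℂ) = 0 := by
    simpa using atSite_add i (0 : Matrix (n i) (n i) ℂ) 0
  have h := atSite_add i X (-X)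
  rw [add_neg_cancel, h0] at h
  exact (neg_eq_of_add_eq_zero_right h.symm).symm

variable [∀ i, Fintype (n i)]

lemma atSite_mul_piKron (i : ι) (X : Matrix (n i) (n i) ℂ) (B : ∀ i, Matrix (n i) (n i) ℂ) :
    atSite i X * piKron B = piKron (Function.update B i (X * B i)) := by
  rw [atSite, piKron_mul]
  congr 1
  ext1 j
  rcases eq_or_ne j i with rfl | h <;> simp [*]

lemma piKron_mul_atSite (i : ι) (X : Matrix (n i) (n i) ℂ) (B : ∀ i, Matrix (n i) (n i) ℂ) :
    piKron B * atSite i X = piKron (Function.update B i (B i * X)) := by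
  rw [atSite, piKron_mul]
  congr 1
  ext1 j
  rcases eq_or_ne j i with rfl | h <;> simp [*]

lemma atSite_mul (i : ι) (X Y : Matrix (n i) (n i) ℂ) :
    atSite i X * atSite i Y = atSite i (X * Y) := by
  rw [atSite.eq_def i Y, atSite_mul_piKron]
  simp [atSite]

/-- A tensor product annihilates every vector that one of its factors annihilates. -/
lemma piKron_mulVec_eq_zero {C : ∀ i, Matrix (n i) (n i) ℂ} {v : (∀ i, n i) → ℂ} {i : ι}
    (h : atSite i (C i) *ᵥ v = 0) : piKron C *ᵥ v = 0 := by
  have hC := piKron_mul_atSite i (C i) (Function.update C i 1)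
  rw [Function.update_self, one_mul, Function.update_idem, Function.update_eq_self] at hC
  rw [← hC, ← Matrix.mulVec_mulVec, h, Matrix.mulVec_zero]

end PiKron

section SquaredNorm

variable {P : Type*} [Fintype P]

/-- The squared Euclidean norm of a complex vector. -/
def nsq (v : P → ℂ) : ℝ := ∑ x, ‖v x‖ ^ 2

lemma star_dotProduct_self (v : P → ℂ) : star v ⬝ᵥ v = (nsq v : ℂ) := by
  simp only [nsq, dotProduct, Pi.star_apply, RCLike.star_def, Complex.conj_mul']
  push_cast
  rfl

lemma nsq_nonneg (v : P → ℂ) : 0 ≤ nsq v := Finset.sum_nonneg fun _ _ => by positivity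

lemma nsq_eq_zero {v : P → ℂ} (h : nsq v ≤ 0) : v = 0 := by
  have h0 := (Finset.sum_eq_zero_iff_of_nonneg (fun x _ => by positivity)).1
    (le_antisymm h (nsq_nonneg v))
  ext x
  simpa using h0 x (Finset.mem_univ x)

lemma nsq_smul (c : ℂ) (v : P → ℂ) : nsq (c • v) = ‖c‖ ^ 2 * nsq v := by
  simp [nsq, Finset.mul_sum, mul_pow]

lemma star_mulVec_dotProduct (M : Matrix P P ℂ) (v w : P → ℂ) :
    star (M *ᵥ v) ⬝ᵥ w = star v ⬝ᵥ (Mᴴ *ᵥ w) := by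
  rw [Matrix.star_mulVec, Matrix.dotProduct_mulVec]

lemma nsq_mulVec (M : Matrix P P ℂ) (v : P → ℂ) :
    (nsq (M *ᵥ v) : ℂ) = star v ⬝ᵥ ((Mᴴ * M) *ᵥ v) := by
  rw [← star_dotProduct_self, star_mulVec_dotProduct, Matrix.mulVec_mulVec]

lemma nsq_sub (v w : P → ℂ) : nsq (v - w) = nsq v + nsq w - 2 * (star w ⬝ᵥ v).re := by
  have h : star v ⬝ᵥ w = star (star w ⬝ᵥ v) := by rw [Matrix.star_dotProduct]
  have := star_dotProduct_self (v - w)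
  rw [star_sub, sub_dotProduct, dotProduct_sub, dotProduct_sub, star_dotProduct_self,
    star_dotProduct_self, h] at this
  have := congrArg Complex.re this
  simp at this
  linarith

/-- A Kraus family preserves the squared norm. -/
lemma sum_nsq_mulVec [DecidableEq P] {κ : Type*} [Fintype κ] (E : κ → Matrix P P ℂ)
    (hE : ∑ b, (E b)ᴴ * E b = 1) (v : P → ℂ) : ∑ b, nsq (E b *ᵥ v) = nsq v := by
  have : ((∑ b, nsq (E b *ᵥ v) : ℝ) : ℂ) = nsq v := by
    push_cast
    simp_rw [nsq_mulVec]
    rw [← dotProduct_sum, ← Matrix.sum_mulVec, hE, Matrix.one_mulVec, star_dotProduct_self]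
  exact_mod_cast this

/-- Rigidity in the sum-of-squares bound `T R + (T R)ᴴ ≤ 1`. -/
lemma mulVec_eq_of_maximal [DecidableEq P] {T R : Matrix P P ℂ} {ψ : P → ℂ} (hψ : nsq ψ = 1)
    (hT : Tᴴ * T + T * Tᴴ = 1) (hcomm : T * R = R * T)
    (hmax : (star ψ ⬝ᵥ ((T * R) *ᵥ ψ)).re = 1 / 2)
    (hR : nsq (R *ᵥ ψ) + nsq (Rᴴ *ᵥ ψ) ≤ 1) :
    R *ᵥ ψ = Tᴴ *ᵥ ψ ∧ Rᴴ *ᵥ ψ = T *ᵥ ψ := by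
  have h1 : nsq (T *ᵥ ψ) + nsq (Tᴴ *ᵥ ψ) = 1 := by
    have := sum_nsq_mulVec (fun b : Fin 2 => if b = 0 then T else Tᴴ) (by simpa using hT) ψ
    simpa [hψ] using this
  have h2 : (star (Tᴴ *ᵥ ψ) ⬝ᵥ (R *ᵥ ψ)).re = 1 / 2 := by
    rw [star_mulVec_dotProduct, Matrix.mulVec_mulVec, Matrix.conjTranspose_conjTranspose, hmax]
  have h3 : (star (T *ᵥ ψ) ⬝ᵥ (Rᴴ *ᵥ ψ)).re = 1 / 2 := by
    rw [← Complex.conj_re, ← hmax, hcomm, starRingEnd_apply, ← Matrix.star_dotProduct,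
      star_mulVec_dotProduct, Matrix.mulVec_mulVec, Matrix.conjTranspose_conjTranspose]
  have h4 := nsq_sub (R *ᵥ ψ) (Tᴴ *ᵥ ψ)
  have h5 := nsq_sub (Rᴴ *ᵥ ψ) (T *ᵥ ψ)
  have h6 := nsq_nonneg (R *ᵥ ψ - Tᴴ *ᵥ ψ)
  have h7 := nsq_nonneg (Rᴴ *ᵥ ψ - T *ᵥ ψ)
  exact ⟨sub_eq_zero.1 (nsq_eq_zero (by linarith)), sub_eq_zero.1 (nsq_eq_zero (by linarith))⟩

end SquaredNorm

section Ladder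

/-- A matrix and its adjoint, indexed by a bit: `0` gives `Tᴴ` and `1` gives `T`. -/
def ladder {m : Type*} (T : Matrix m m ℂ) : Fin 2 → Matrix m m ℂ := ![Tᴴ, T]

@[simp]
lemma ladder_zero {m : Type*} (T : Matrix m m ℂ) : ladder T 0 = Tᴴ := rfl

@[simp]
lemma ladder_one {m : Type*} (T : Matrix m m ℂ) : ladder T 1 = T := rfl

variable {ι : Type*} [Fintype ι] {n : ι → Type*}

/-- The tensor product in which the factor `i` is `T i` or its adjoint according to `b i`. -/
def ladderWord (T : ∀ i, Matrix (n i) (n i) ℂ) (b : ι → Fin 2) :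
    Matrix (∀ i, n i) (∀ i, n i) ℂ :=
  piKron fun i => ladder (T i) (b i)

variable [DecidableEq ι] [∀ i, DecidableEq (n i)]

/-- The tensor product `ladderWord T b` with the factor `i` replaced by the identity. -/
def puncturedWord (T : ∀ i, Matrix (n i) (n i) ℂ) (i : ι) (b : ι → Fin 2) :
    Matrix (∀ i, n i) (∀ i, n i) ℂ :=
  piKron (Function.update (fun j => ladder (T j) (b j)) i 1)

lemma puncturedWord_conjTranspose (T : ∀ i, Matrix (n i) (n i) ℂ) (i : ι) :
    (puncturedWord T i fun _ => 1)ᴴ = puncturedWord T i fun _ => 0 := by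
  rw [puncturedWord, puncturedWord, piKron_conjTranspose]
  congr 1
  ext1 j
  rcases eq_or_ne j i with rfl | h <;> simp [*]

variable [∀ i, Fintype (n i)]

lemma atSite_mul_puncturedWord (T : ∀ i, Matrix (n i) (n i) ℂ) (i : ι) (a : Fin 2)
    (b : ι → Fin 2) :
    atSite i (ladder (T i) a) * puncturedWord T i b = ladderWord T (Function.update b i a) := by
  rw [puncturedWord, atSite_mul_piKron, ladderWord]
  congr 1
  ext1 j
  rcases eq_or_ne j i with rfl | h <;> simp [*]

lemma puncturedWord_mul_atSite (T : ∀ i, Matrix (n i) (n i) ℂ) (i : ι) (a : Fin 2)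
    (b : ι → Fin 2) :
    puncturedWord T i b * atSite i (ladder (T i) a) = ladderWord T (Function.update b i a) := by
  rw [puncturedWord, piKron_mul_atSite, ladderWord]
  congr 1
  ext1 j
  rcases eq_or_ne j i with rfl | h <;> simp [*]

variable {T : ∀ i, Matrix (n i) (n i) ℂ} (hT : ∀ i, (T i)ᴴ * T i + T i * (T i)ᴴ = 1)

include hT

lemma sum_nsq_ladderWord (v : (∀ i, n i) → ℂ) : ∑ b, nsq (ladderWord T b *ᵥ v) = nsq v := by
  refine sum_nsq_mulVec _ ?_ v
  simp_rw [ladderWord, piKron_conjTranspose, piKron_mul]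
  rw [← piKron_sum fun i b => (ladder (T i) b)ᴴ * ladder (T i) b, ← piKron_one]
  congr 1
  ext1 i
  rw [Fin.sum_univ_two, add_comm]
  simpa using hT i

lemma sum_nsq_update (i : ι) (b : ι → Fin 2) (v : (∀ i, n i) → ℂ) :
    ∑ a, nsq (ladderWord T (Function.update b i a) *ᵥ v) = nsq (puncturedWord T i b *ᵥ v) := by
  simp_rw [← atSite_mul_puncturedWord, ← Matrix.mulVec_mulVec]
  refine sum_nsq_mulVec _ ?_ _
  simp_rw [atSite_conjTranspose, atSite_mul]
  rw [Fin.sum_univ_two, ← atSite_add, ← atSite_one i, add_comm]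
  congr 1
  simpa using hT i

lemma sum_image_nsq {i k : ι} (hk : k ≠ i) (v : (∀ i, n i) → ℂ) :
    ∑ b ∈ Finset.univ.image
        (fun ca : Fin 2 × Fin 2 => Function.update (fun _ : ι => ca.1) i ca.2),
      nsq (ladderWord T b *ᵥ v) =
    nsq (puncturedWord T i (fun _ => 1) *ᵥ v) + nsq (puncturedWord T i (fun _ => 0) *ᵥ v) := by
  rw [Finset.sum_image, Fintype.sum_prod_type, Fin.sum_univ_two, add_comm,
    ← sum_nsq_update hT, ← sum_nsq_update hT]
  rintro ⟨c, a⟩ - ⟨c', a'⟩ - h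
  have h1 := congrFun h k
  have h2 := congrFun h i
  simp_all

variable {ψ : (∀ i, n i) → ℂ} (hψ : nsq ψ = 1) {ω : ℂ} (hω : ‖ω‖ = 1)
  (hmax : (star ψ ⬝ᵥ ((ω • piKron T) *ᵥ ψ)).re = 1 / 2)

include hψ hω hmax

lemma puncturedWord_mulVec {i k : ι} (hk : k ≠ i) :
    ω • (puncturedWord T i (fun _ => 1) *ᵥ ψ) = atSite i (T i)ᴴ *ᵥ ψ ∧
      star ω • (puncturedWord T i (fun _ => 0) *ᵥ ψ) = atSite i (T i) *ᵥ ψ := by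
  have hle : nsq (puncturedWord T i (fun _ => 1) *ᵥ ψ) +
      nsq (puncturedWord T i (fun _ => 0) *ᵥ ψ) ≤ 1 := by
    rw [← sum_image_nsq hT hk, ← hψ, ← sum_nsq_ladderWord hT ψ]
    exact Finset.sum_le_sum_of_subset_of_nonneg (Finset.subset_univ _)
      fun _ _ _ => nsq_nonneg _
  have hw : ladderWord T (Function.update (fun _ => 1) i 1) = piKron T := by
    rw [Function.update_eq_self]
    rfl
  have h := mulVec_eq_of_maximal (T := atSite i (T i))
    (R := ω • puncturedWord T i (fun _ => 1)) hψ ?_ ?_ ?_ ?_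
  · rwa [Matrix.conjTranspose_smul, puncturedWord_conjTranspose, Matrix.smul_mulVec,
      Matrix.smul_mulVec, atSite_conjTranspose] at h
  · rw [atSite_conjTranspose, atSite_mul, atSite_mul, ← atSite_add, hT, atSite_one]
  · have h1 := atSite_mul_puncturedWord T i 1 fun _ => 1
    have h2 := puncturedWord_mul_atSite T i 1 fun _ => 1
    rw [ladder_one] at h1 h2
    rw [Matrix.mul_smul, Matrix.smul_mul, h1, h2]
  · have h1 := atSite_mul_puncturedWord T i 1 fun _ => 1
    rw [ladder_one] at h1
    rw [Matrix.mul_smul, h1, hw, hmax]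
  · rw [Matrix.conjTranspose_smul, puncturedWord_conjTranspose, Matrix.smul_mulVec,
      Matrix.smul_mulVec, nsq_smul, nsq_smul, norm_star, hω]
    simpa using hle

lemma ladderWord_update_mulVec {i k : ι} (hk : k ≠ i) (a : Fin 2) :
    ω • (ladderWord T (Function.update (fun _ => 1) i a) *ᵥ ψ) =
        atSite i (ladder (T i) a * (T i)ᴴ) *ᵥ ψ ∧
      star ω • (ladderWord T (Function.update (fun _ => 0) i a) *ᵥ ψ) =
        atSite i (ladder (T i) a * T i) *ᵥ ψ := by
  obtain ⟨h1, h0⟩ := puncturedWord_mulVec hT hψ hω hmax hk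
  constructor
  · rw [← atSite_mul_puncturedWord, ← Matrix.mulVec_mulVec, ← Matrix.mulVec_smul, h1,
      Matrix.mulVec_mulVec, atSite_mul]
  · rw [← atSite_mul_puncturedWord, ← Matrix.mulVec_mulVec, ← Matrix.mulVec_smul, h0,
      Matrix.mulVec_mulVec, atSite_mul]

lemma ladderWord_mulVec_eq_zero_of_forall_ne {i k : ι} (hk : k ≠ i) {b : ι → Fin 2}
    (hb : ∀ c a, b ≠ Function.update (fun _ => c) i a) : ladderWord T b *ᵥ ψ = 0 := by
  obtain ⟨h1, h0⟩ := puncturedWord_mulVec hT hψ hω hmax hk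
  have hsum : nsq (puncturedWord T i (fun _ => 1) *ᵥ ψ) +
      nsq (puncturedWord T i (fun _ => 0) *ᵥ ψ) = 1 := by
    have h := sum_nsq_mulVec (fun a : Fin 2 => atSite i (ladder (T i) a)) ?_ ψ
    · rw [Fin.sum_univ_two, ladder_zero, ladder_one, ← h1, ← h0, nsq_smul, nsq_smul, norm_star,
        hω, hψ] at h
      simpa using h
    · simp_rw [atSite_conjTranspose, atSite_mul]
      rw [Fin.sum_univ_two, ← atSite_add, ← atSite_one i, add_comm]
      congr 1
      simpa using hT i
  rw [← sum_image_nsq hT hk] at hsum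
  have htot := sum_nsq_ladderWord hT ψ
  rw [hψ] at htot
  apply nsq_eq_zero
  set s := Finset.univ.image
    (fun ca : Fin 2 × Fin 2 => Function.update (fun _ : ι => ca.1) i ca.2)
  have hbs : b ∉ s := by
    intro h
    obtain ⟨⟨c, a⟩, -, h⟩ := Finset.mem_image.1 h
    exact hb c a h.symm
  have := Finset.sum_le_sum_of_subset_of_nonneg (f := fun b => nsq (ladderWord T b *ᵥ ψ))
    (Finset.subset_univ (insert b s)) fun _ _ _ => nsq_nonneg _
  rw [Finset.sum_insert hbs] at this
  linarith

variable (hω4 : ω ^ 4 = -1) (hTsq : ∀ i, T i * T i = -((T i)ᴴ * (T i)ᴴ)) [Nontrivial ι]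

include hω4 hTsq

/-- Words mixing `T` and its adjoint annihilate a maximally violating state. -/
lemma ladderWord_mulVec_eq_zero {b : ι → Fin 2} (hb : ∀ c, b ≠ fun _ => c) :
    ladderWord T b *ᵥ ψ = 0 := by
  have hωs : star ω * ω = 1 := by
    rw [Complex.star_def, Complex.conj_mul', hω]
    norm_num
  have flip : ∀ i : ι, ω • (ladderWord T (Function.update (fun _ => 1) i 0) *ᵥ ψ) =
      -(star ω • (ladderWord T (Function.update (fun _ => 0) i 1) *ᵥ ψ)) := by
    intro i
    obtain ⟨k, hk⟩ := exists_ne i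
    rw [(ladderWord_update_mulVec hT hψ hω hmax hk 0).1,
      (ladderWord_update_mulVec hT hψ hω hmax hk 1).2, ladder_zero, ladder_one, hTsq, atSite_neg,
      Matrix.neg_mulVec, neg_neg]
  by_contra hne
  have key : ∀ i, b = Function.update (fun _ => 1) i 0 ∨ b = Function.update (fun _ => 0) i 1 := by
    intro i
    obtain ⟨k, hk⟩ := exists_ne i
    by_contra! h
    refine hne (ladderWord_mulVec_eq_zero_of_forall_ne hT hψ hω hmax hk fun c a => ?_)
    rcases eq_or_ne a c with rfl | hac
    · simpa [Function.update_eq_self] using hb a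
    · fin_cases c <;> fin_cases a <;> simp_all
  have main : ∀ i k : ι, k ≠ i → b = Function.update (fun _ => 1) i 0 →
      b = Function.update (fun _ => 0) k 1 → False := by
    intro i k hk hi hk'
    have hcompl : (Function.update (fun _ => 0) i 1 : ι → Fin 2) =
        Function.update (fun _ => 1) k 0 := by
      ext1 j
      have := congrFun (hi.symm.trans hk') j
      rcases eq_or_ne j i with rfl | h1 <;> rcases eq_or_ne j k with rfl | h2 <;> simp_all
    have e1 := flip i
    have e2 := flip k
    rw [← hi, hcompl] at e1
    rw [← hk'] at e2
    apply hne
    set u := ladderWord T b *ᵥ ψ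
    set v := ladderWord T (Function.update (fun _ => 1) k 0) *ᵥ ψ
    have e3 : ω ^ 4 • u = u := by
      calc ω ^ 4 • u = ω ^ 3 • (ω • u) := by rw [smul_smul]; ring_nf
        _ = -((ω * (star ω * ω)) • (ω • v)) := by rw [e1, smul_neg, smul_smul, smul_smul]; ring_nf
        _ = ((star ω * ω) * (star ω * ω)) • u := by rw [e2, smul_neg, neg_neg, smul_smul]; ring_nf
        _ = u := by rw [hωs]; simp
    rw [hω4, neg_one_smul] at e3
    exact self_eq_neg.1 e3.symm
  obtain ⟨i, k, hik⟩ := exists_pair_ne ι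
  rcases key i with hi | hi <;> rcases key k with hk | hk
  · have := congrFun (hi.symm.trans hk) i
    simp [hik] at this
  · exact main i k hik.symm hi hk
  · exact main k i hik hk hi
  · have := congrFun (hi.symm.trans hk) i
    simp [hik] at this

lemma atSite_conjTranspose_sq_mulVec (i : ι) : atSite i ((T i)ᴴ * (T i)ᴴ) *ᵥ ψ = 0 := by
  obtain ⟨k, hk⟩ := exists_ne i
  have h := (ladderWord_update_mulVec hT hψ hω hmax hk 0).1
  rw [ladder_zero] at h
  rw [← h, ladderWord_mulVec_eq_zero hT hψ hω hmax hω4 hTsq, smul_zero]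
  intro c hc
  have h1 := congrFun hc i
  have h2 := congrFun hc k
  simp only [Function.update_self, Function.update_of_ne hk] at h1 h2
  simp [← h2] at h1

lemma piKron_mulVec_ladderWord_zero :
    piKron T *ᵥ (ladderWord T (fun _ => 0) *ᵥ ψ) = ω • (piKron T *ᵥ ψ) := by
  have hsq := atSite_conjTranspose_sq_mulVec hT hψ hω hmax hω4 hTsq
  have hωs : ω * star ω = 1 := by
    rw [Complex.star_def, Complex.mul_conj', hω]
    norm_num
  have hw1 : ladderWord T (fun _ => 1) = piKron T := rfl
  obtain ⟨i⟩ : Nonempty ι := inferInstance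
  obtain ⟨k, hk⟩ := exists_ne i
  have hresolve : ω • (piKron T *ᵥ ψ) + star ω • (ladderWord T (fun _ => 0) *ᵥ ψ) = ψ := by
    have h1 := (ladderWord_update_mulVec hT hψ hω hmax hk 1).1
    have h0 := (ladderWord_update_mulVec hT hψ hω hmax hk 0).2
    rw [Function.update_eq_self, hw1] at h1
    rw [Function.update_eq_self] at h0
    rw [h1, h0, ← Matrix.add_mulVec, ← atSite_add, ladder_one, ladder_zero, add_comm, hT,
      atSite_one, Matrix.one_mulVec]
  have hu0 : ladderWord T (fun _ => 0) *ᵥ ψ = ω • ψ - (ω * ω) • (piKron T *ᵥ ψ) := by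
    have h := congrArg (ω • ·) hresolve
    simp only [smul_add, smul_smul, hωs, one_smul] at h
    exact eq_sub_of_add_eq' h
  have hTT : piKron T *ᵥ (piKron T *ᵥ ψ) = 0 := by
    rw [Matrix.mulVec_mulVec, piKron_mul]
    apply piKron_mulVec_eq_zero (i := i)
    rw [hTsq, atSite_neg, Matrix.neg_mulVec, hsq, neg_zero]
  rw [hu0, Matrix.mulVec_sub, Matrix.mulVec_smul, Matrix.mulVec_smul, hTT, smul_zero, sub_zero]

/-- The self-adjoint parts `T i + (T i)ᴴ` jointly exchange the two branches of the state. -/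
lemma piKron_add_mulVec : piKron (fun i => T i + (T i)ᴴ) *ᵥ (ladderWord T (fun _ => 0) *ᵥ ψ) =
    ω • (piKron T *ᵥ ψ) := by
  have hexp : piKron (fun i => T i + (T i)ᴴ) = ∑ b, ladderWord T b := by
    simp_rw [ladderWord, ← piKron_sum, Fin.sum_univ_two, ladder_zero, ladder_one, add_comm]
  rw [hexp, Matrix.sum_mulVec, Finset.sum_eq_single (fun _ => 1)]
  · exact piKron_mulVec_ladderWord_zero hT hψ hω hmax hω4 hTsq
  · intro b _ hb
    obtain ⟨j, hj⟩ : ∃ j, b j = 0 := by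
      by_contra! h
      exact hb (funext fun j => Fin.eq_one_of_ne_zero _ (h j))
    rw [Matrix.mulVec_mulVec, ladderWord, ladderWord, piKron_mul]
    apply piKron_mulVec_eq_zero (i := j)
    rw [hj, ladder_zero, atSite_conjTranspose_sq_mulVec hT hψ hω hmax hω4 hTsq]
  · simp

lemma nsq_ladderWord_zero : nsq (ladderWord T (fun _ => 0) *ᵥ ψ) = 1 / 2 := by
  have hadj : (ladderWord T fun _ => 0)ᴴ = piKron T := by
    rw [ladderWord, piKron_conjTranspose]
    simp
  rw [← hmax, Matrix.smul_mulVec, ← piKron_mulVec_ladderWord_zero hT hψ hω hmax hω4 hTsq,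
    Matrix.mulVec_mulVec, ← hadj, ← nsq_mulVec, Complex.ofReal_re]

end Ladder

section Svetlichny

lemma svetlichny_coeff (w : ℕ) :
    (1 + Complex.I) * Complex.I ^ w + (1 - Complex.I) * (-Complex.I) ^ w =
      2 * (-1) ^ (w * (w + 1) / 2) := by
  have hI := Complex.I_sq
  induction w using Nat.strong_induction_on with
  | _ w ih =>
    rcases Nat.lt_or_ge w 2 with h | h
    · interval_cases w
      · norm_num
      · norm_num
        linear_combination 2 * hI
    · obtain ⟨v, rfl⟩ := Nat.exists_eq_add_of_le' h
      have he : (v + 2) * (v + 2 + 1) / 2 = v * (v + 1) / 2 + 2 * v + 3 := by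
        rw [show (v + 2) * (v + 2 + 1) = v * (v + 1) + 2 * (2 * v + 3) by ring,
          Nat.add_mul_div_left _ _ two_pos]
        ring
      have := ih v (by lia)
      rw [he, pow_add, pow_add, neg_sq, hI, pow_add, pow_add, pow_mul _ 2 v]
      norm_num
      linear_combination -this

/-- The primitive eighth root of unity `(1 + i)/√2`. -/
def eighthRoot : ℂ := (1 + Complex.I) / (Real.sqrt 2 : ℂ)

lemma sqrt_two_sq : (Real.sqrt 2 : ℂ) ^ 2 = 2 := by
  rw [← Complex.ofReal_pow, Real.sq_sqrt zero_le_two]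
  norm_num

lemma eighthRoot_pow_four : eighthRoot ^ 4 = -1 := by
  have h4 : (Real.sqrt 2 : ℂ) ^ 4 = 4 := by
    rw [show 4 = 2 * 2 from rfl, pow_mul, sqrt_two_sq]
    norm_num
  rw [eighthRoot, div_pow, h4]
  linear_combination ((Complex.I ^ 2 + 4 * Complex.I + 5) / 4) * Complex.I_sq

lemma norm_eighthRoot : ‖eighthRoot‖ = 1 := by
  have h := congrArg norm eighthRoot_pow_four
  rw [norm_pow, norm_neg, norm_one] at h
  exact (pow_eq_one_iff_of_nonneg (norm_nonneg _) (by norm_num)).1 h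

/-- The operator `(A₀ + i A₁)/2` of a pair of observables. -/
def halfSum {m : Type*} (A : Fin 2 → Matrix m m ℂ) : Matrix m m ℂ :=
  ∑ b : Fin 2, ((1 / 2 : ℂ) * Complex.I ^ (b : ℕ)) • A b

variable {m : Type*} {A : Fin 2 → Matrix m m ℂ}

lemma halfSum_conjTranspose (hA : ∀ b, (A b).IsHermitian) :
    (halfSum A)ᴴ = ∑ b : Fin 2, ((1 / 2 : ℂ) * (-Complex.I) ^ (b : ℕ)) • A b := by
  simp [halfSum, Fin.sum_univ_two, (hA _).eq]

lemma halfSum_add_conjTranspose (hA : ∀ b, (A b).IsHermitian) :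
    halfSum A + (halfSum A)ᴴ = A 0 := by
  rw [halfSum_conjTranspose hA]
  simp only [halfSum, Fin.sum_univ_two]
  simp
  module

variable [Fintype m] [DecidableEq m]

lemma halfSum_anticomm (hA : ∀ b, (A b).IsHermitian) (hsq : ∀ b, A b * A b = 1) :
    (halfSum A)ᴴ * halfSum A + halfSum A * (halfSum A)ᴴ = 1 := by
  rw [halfSum_conjTranspose hA]
  simp [halfSum, Fin.sum_univ_two, add_mul, mul_add, hsq, smul_smul]
  match_scalars <;> first | ring1 | linear_combination (-1 / 2 : ℂ) * Complex.I_sq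

lemma halfSum_sq (hA : ∀ b, (A b).IsHermitian) (hsq : ∀ b, A b * A b = 1) :
    halfSum A * halfSum A = -((halfSum A)ᴴ * (halfSum A)ᴴ) := by
  rw [halfSum_conjTranspose hA]
  simp [halfSum, Fin.sum_univ_two, add_mul, mul_add, hsq, smul_smul]
  match_scalars <;> first | ring1 | linear_combination (1 / 2 : ℂ) * Complex.I_sq

lemma svetOp_eq {N : ℕ} (hN : 1 ≤ N) {d : Fin N → ℕ}
    (A : (i : Fin N) → Fin 2 → Matrix (Fin (d i)) (Fin (d i)) ℂ)
    (hA : ∀ i b, (A i b).IsHermitian) :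
    svetOp A = (2 ^ (N - 1) * Real.sqrt 2 : ℂ) •
      (eighthRoot • piKron (fun i => halfSum (A i)) +
        (eighthRoot • piKron (fun i => halfSum (A i)))ᴴ) := by
  have hexp : ∀ z : ℂ, piKron (fun i => ∑ b : Fin 2, ((1 / 2 : ℂ) * z ^ (b : ℕ)) • A i b) =
      ∑ x : Fin N → Fin 2, ((1 / 2) ^ N * z ^ wt x) • piKron fun i => A i (x i) := by
    intro z
    rw [piKron_sum]
    refine Finset.sum_congr rfl fun x _ => ?_
    rw [piKron_smul, Finset.prod_mul_distrib, Finset.prod_pow_eq_pow_sum]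
    simp [wt]
  rw [Matrix.conjTranspose_smul, piKron_conjTranspose]
  simp_rw [halfSum_conjTranspose (hA _)]
  simp_rw [halfSum, hexp, Finset.smul_sum]
  rw [← Finset.sum_add_distrib, Finset.smul_sum]
  refine Finset.sum_congr rfl fun x _ => ?_
  rw [smul_smul, smul_smul, ← add_smul, smul_smul]
  congr 1
  have hs : (Real.sqrt 2 : ℂ) ≠ 0 := by simp
  have hc := svetlichny_coeff (wt x)
  obtain ⟨k, rfl⟩ := Nat.exists_eq_add_of_le' hN
  have h2 : (2 : ℂ) ^ k * (1 / 2) ^ (k + 1) = 1 / 2 := by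
    rw [pow_succ, ← mul_assoc, ← mul_pow]
    norm_num
  rw [sgn, eighthRoot]
  simp only [star_div₀, star_add, star_one, Complex.star_def, Complex.conj_I, Complex.conj_ofReal,
    Nat.add_sub_cancel]
  linear_combination (-1 / 2) * hc -
    ((1 + Complex.I) * Complex.I ^ wt x + (1 - Complex.I) * (-Complex.I) ^ wt x) *
      (h2 + 2 ^ k * (1 / 2) ^ (k + 1) * mul_inv_cancel₀ hs)

/-- The maximal Svetlichny value forces `Re ⟨ψ, ω (⊗ T) ψ⟩ = 1/2`. -/
lemma re_eq_half_of_maximal {N : ℕ} (hN : 1 ≤ N) {d : Fin N → ℕ}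
    (A : (i : Fin N) → Fin 2 → Matrix (Fin (d i)) (Fin (d i)) ℂ)
    (hA : ∀ i b, (A i b).IsHermitian) {ψ : ((i : Fin N) → Fin (d i)) → ℂ}
    (hmax : ∑ p, (starRingEnd ℂ) (ψ p) * (svetOp A).mulVec ψ p =
      ((2 ^ (N - 1) * Real.sqrt 2 : ℝ) : ℂ)) :
    (star ψ ⬝ᵥ ((eighthRoot • piKron fun i => halfSum (A i)) *ᵥ ψ)).re = 1 / 2 := by
  set M := eighthRoot • piKron fun i => halfSum (A i) with hM
  change star ψ ⬝ᵥ (svetOp A *ᵥ ψ) = _ at hmax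
  have hadj : star ψ ⬝ᵥ (Mᴴ *ᵥ ψ) = star (star ψ ⬝ᵥ (M *ᵥ ψ)) := by
    rw [← star_mulVec_dotProduct, Matrix.star_dotProduct]
  rw [svetOp_eq hN A hA, ← hM, Matrix.smul_mulVec, dotProduct_smul, Matrix.add_mulVec,
    dotProduct_add, hadj, smul_eq_mul] at hmax
  push_cast at hmax
  have hne : (2 ^ (N - 1) * Real.sqrt 2 : ℂ) ≠ 0 := by simp
  have h := congrArg Complex.re (mul_left_cancel₀ hne (hmax.trans (mul_one _).symm))
  simp only [Complex.add_re, Complex.star_def, Complex.conj_re, Complex.one_re] at h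
  linarith

end Svetlichny

/-- Corollary 1 (standard self-testing of the GHZ state from the Svetlichny inequality,
state part): any unit state maximally violating `Ŝ_N^+` is mapped by local isometries to the
`N`-partite GHZ state tensored with uncorrelated degrees of freedom. -/
theorem stmt_16 (N : ℕ) (hN : 2 ≤ N) (d : Fin N → ℕ)
    (A : (i : Fin N) → Fin 2 → Matrix (Fin (d i)) (Fin (d i)) ℂ)
    (hAherm : ∀ i b, (A i b).IsHermitian) (hAsq : ∀ i b, A i b * A i b = 1)
    (ψ : ((i : Fin N) → Fin (d i)) → ℂ) (hψ : (∑ x, ‖ψ x‖ ^ 2) = 1)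
    (hmax : ∑ p, (starRingEnd ℂ) (ψ p) * (svetOp A).mulVec ψ p =
      ((2 ^ (N - 1) * Real.sqrt 2 : ℝ) : ℂ)) :
    ∃ (m : Fin N → ℕ) (V : (i : Fin N) → Matrix (Fin 2 × Fin (m i)) (Fin (d i)) ℂ)
      (ζ : ((i : Fin N) → Fin (m i)) → ℂ),
      (∀ i, (V i)ᴴ * V i = 1) ∧ (∑ a, ‖ζ a‖ ^ 2) = 1 ∧
        ∀ f : (i : Fin N) → Fin 2 × Fin (m i),
          tensorIsoAct V ψ f = ghzVec (fun i => (f i).1) * ζ (fun i => (f i).2) := by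
  have : Nontrivial (Fin N) := Fin.nontrivial_iff_two_le.2 hN
  set T : ∀ i, Matrix (Fin (d i)) (Fin (d i)) ℂ := fun i => halfSum (A i)
  have hT : ∀ i, (T i)ᴴ * T i + T i * (T i)ᴴ = 1 := fun i => halfSum_anticomm (hAherm i) (hAsq i)
  have hTsq : ∀ i, T i * T i = -((T i)ᴴ * (T i)ᴴ) := fun i => halfSum_sq (hAherm i) (hAsq i)
  have hω := norm_eighthRoot
  have hω4 := eighthRoot_pow_four
  have hre : (star ψ ⬝ᵥ ((eighthRoot • piKron T) *ᵥ ψ)).re = 1 / 2 :=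
    re_eq_half_of_maximal (by lia) A hAherm hmax
  have hA0 : (fun i => T i + (T i)ᴴ) = fun i => A i 0 :=
    funext fun i => halfSum_add_conjTranspose (hAherm i)
  have hswap := piKron_add_mulVec hT hψ hω hre hω4 hTsq
  rw [hA0] at hswap
  have hzero : ∀ b : Fin N → Fin 2, (∀ c, b ≠ fun _ => c) → ladderWord T b *ᵥ ψ = 0 :=
    fun b => ladderWord_mulVec_eq_zero hT hψ hω hre hω4 hTsq
  have hnorm : nsq (eighthRoot • (piKron T *ᵥ ψ)) = 1 / 2 := by
    rw [← nsq_ladderWord_zero hT hψ hω hre hω4 hTsq, ← hswap]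
    have h := sum_nsq_mulVec (fun _ : Unit => piKron fun i => A i 0) ?_
      (ladderWord T (fun _ => 0) *ᵥ ψ)
    · simpa using h
    · simp [piKron_conjTranspose, piKron_mul, (hAherm _ _).eq, hAsq, piKron_one]
  obtain ⟨i₀⟩ : Nonempty (Fin N) := inferInstance
  let F : (i : Fin N) → Fin 2 → Matrix (Fin (d i)) (Fin (d i)) ℂ := fun i =>
    ![A i 0, (if i = i₀ then eighthRoot else 1) • 1]
  let B : (i : Fin N) → Fin 2 → Matrix (Fin (d i)) (Fin (d i)) ℂ := fun i b =>
    F i b * ladder (T i) b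
  have hF : ∀ i b, (F i b)ᴴ * F i b = 1 := by
    intro i b
    fin_cases b
    · simp [F, (hAherm _ _).eq, hAsq]
    · by_cases hi : i = i₀
      · simp [F, hi, smul_smul, Complex.mul_conj', hω]
      · simp [F, hi]
  have hB : ∀ b : Fin N → Fin 2, piKron (fun i => B i (b i)) *ᵥ ψ =
      piKron (fun i => F i (b i)) *ᵥ (ladderWord T b *ᵥ ψ) := by
    intro b
    rw [Matrix.mulVec_mulVec, ladderWord, piKron_mul]
  have hB' : ∀ b : Fin N → Fin 2, piKron (fun i => B i (b i)) *ᵥ ψ =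
      (ghzVec b * (Real.sqrt 2 : ℂ)) • (eighthRoot • (piKron T *ᵥ ψ)) := by
    intro b
    have hs : (Real.sqrt 2 : ℂ) ≠ 0 := by simp
    rw [hB, ghzVec, div_mul_cancel₀ _ hs]
    by_cases h0 : b = fun _ => 0
    · subst h0
      simp [F, hswap, funext_iff]
    by_cases h1 : b = fun _ => 1
    · subst h1
      have hF1 : piKron (fun i => F i 1) = eighthRoot • 1 := by
        simp only [F, Matrix.cons_val_one, Matrix.cons_val_fin_one]
        rw [piKron_smul, piKron_one, Fintype.prod_ite_eq']
      rw [hF1, Matrix.smul_mulVec, Matrix.one_mulVec, if_neg h0, if_pos rfl, zero_add, one_smul]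
      rfl
    · rw [hzero b, Matrix.mulVec_zero, if_neg h0, if_neg h1, add_zero, zero_smul]
      intro c
      fin_cases c
      · exact h0
      · exact h1
  refine ⟨d, fun i => Matrix.of fun ak q => B i ak.1 ak.2 q,
    (Real.sqrt 2 : ℂ) • (eighthRoot • (piKron T *ᵥ ψ)), fun i => ?_, ?_, fun f => ?_⟩
  · have hsum : ∑ b, (B i b)ᴴ * B i b = 1 := by
      have : ∀ b, (B i b)ᴴ * B i b = (ladder (T i) b)ᴴ * ladder (T i) b := by
        intro b
        rw [Matrix.conjTranspose_mul, Matrix.mul_assoc, ← Matrix.mul_assoc _ (F i b), hF,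
          Matrix.one_mul]
      rw [Fin.sum_univ_two, this, this, add_comm]
      simpa using hT i
    rw [← hsum]
    ext p q
    simp [Matrix.mul_apply, Fintype.sum_prod_type, Matrix.sum_apply]
  · change nsq _ = 1
    rw [nsq_smul, hnorm, Complex.norm_real, Real.norm_eq_abs, sq_abs, Real.sq_sqrt zero_le_two]
    norm_num
  · have h := congrFun (hB' fun i => (f i).1) fun i => (f i).2
    rw [mul_smul] at h
    exact h
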